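/- For every integer k ≥ 1, the continued-fraction value of the list consisting of the pair (−2, 2) repeated k times equals −2k/(2k+1); that is, CF([−2, 2, −2, 2, …, −2, 2]) = −2k/(2k+1) in ℚ, where the list has 2k entries. -/

import Mathlib

/-- Continued-fraction value of a list: `CF [n₁, …, n_t] = 1/(n₁ + 1/(n₂ + ⋯ + 1/n_t))`. -/
def CF (l : List ℚ) : ℚ := l.foldr (fun n x => (n + x)⁻¹) 0

theorem CF_cons (n : ℚ) (l : List ℚ) : CF (n :: l) = (n + CF l)⁻¹ := rfl

/-- For every integer `k ≥ 1`, the continued-fraction value of the pair `(−2, 2)`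
repeated `k` times is `−2k/(2k+1)`. -/
theorem cf_replicate_pair (k : ℕ) (hk : 1 ≤ k) :
    CF (List.flatten (List.replicate k [(-2 : ℚ), 2])) = -(2 * k) / (2 * k + 1) := by
  clear hk
  induction k with
  | zero => simp [CF]
  | succ k ih =>
    have h₁ : (2 * k + 1 : ℚ) ≠ 0 := by positivity
    have h₂ : (2 * k + 2 : ℚ) ≠ 0 := by positivity
    have inner : (2 + -(2 * k) / (2 * k + 1) : ℚ)⁻¹ = (2 * k + 1) / (2 * k + 2) := by
      rw [inv_eq_iff_eq_inv, inv_div, eq_div_iff h₁, add_mul, div_mul_cancel₀ _ h₁]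
      ring
    have outer : (-2 + (2 * k + 1) / (2 * k + 2) : ℚ) = (2 * k + 3) / -(2 * k + 2) := by
      rw [eq_div_iff (neg_ne_zero.mpr h₂), mul_neg, add_mul, div_mul_cancel₀ _ h₂]
      ring
    rw [List.replicate_succ, List.flatten_cons, List.cons_append, List.cons_append,
      List.nil_append, CF_cons, CF_cons, ih, inner, outer, inv_div]
    push_cast
    ring
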